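/- Let U be an ultrafilter on a set ι and let (f i : X i → Z i) be a family of morphisms of simplicial sets such that {i | f i is a Kan fibration} ∈ U. Then the induced morphism between restricted ultraproducts, res(f) : ∏_U X i → ∏_U Z i (defined germwise in each simplicial degree), is a Kan fibration, i.e. it has the right lifting property with respect to every horn inclusion Λᵏ[n] ↪ Δ[n] (n ≥ 1, 0 ≤ k ≤ n). -/

import Mathlib

open CategoryTheory Limits Simplicial

universe v u
universe w

/-- The setoid of `U`-almost-everywhere equality on the dependent product `∀ i, S i`. -/
def germSetoid {ι : Type u} (U : Ultrafilter ι) (S : ι → Type v) :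
    Setoid (∀ i, S i) where
  r s t := {i | s i = t i} ∈ U
  iseqv := by
    constructor
    · intro s
      exact Filter.univ_mem' (fun i => rfl)
    · intro s t h
      exact Filter.mem_of_superset h (fun i hi => hi.symm)
    · intro s t u h₁ h₂
      exact Filter.mem_of_superset (Filter.inter_mem h₁ h₂) (fun i hi => hi.1.trans hi.2)

/-- The ultraproduct `∏_U S i` of a family of sets: the quotient of `∀ i, S i` by
`U`-almost-everywhere equality. -/
def Ultraproduct {ι : Type u} (U : Ultrafilter ι) (S : ι → Type v) : Type (max u v) :=
  Quotient (germSetoid U S)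

/-- The germ `[s]` of a family `s`. -/
def Ultraproduct.mk {ι : Type u} (U : Ultrafilter ι) {S : ι → Type v} (s : ∀ i, S i) :
    Ultraproduct U S :=
  Quotient.mk (germSetoid U S) s

/-- The ultraproduct category `∏_U C i`: objects are families of objects,
hom-sets are ultraproducts of hom-sets, with germwise composition and
germs of identities as identities. -/
def UltraCat {ι : Type u} (U : Ultrafilter ι) (C : ι → Type v)
    [∀ i, Category.{w} (C i)] : Type (max u v) :=
  ∀ i, C i

set_option linter.unusedVariables false in
instance UltraCat.instCategory {ι : Type u} (U : Ultrafilter ι) (C : ι → Type v)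
    [∀ i, Category.{w} (C i)] : Category.{max u w} (UltraCat U C) where
  Hom X Y := Ultraproduct U (fun i => X i ⟶ Y i)
  id X := Ultraproduct.mk U (fun i => 𝟙 (X i))
  comp {X Y Z} f g :=
    Quotient.liftOn₂ f g
      (fun f g => Ultraproduct.mk U (fun i => f i ≫ g i))
      (by
        intro a₁ a₂ b₁ b₂ h₁ h₂
        exact Quotient.sound (Filter.mem_of_superset (Filter.inter_mem h₁ h₂)
          (fun i hi => by
            have e₁ : a₁ i = b₁ i := hi.1
            have e₂ : a₂ i = b₂ i := hi.2
            show a₁ i ≫ a₂ i = b₁ i ≫ b₂ i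
            rw [e₁, e₂])))
  id_comp := by
    intro X Y f
    induction f using Quotient.inductionOn with
    | _ a => exact congrArg (Quotient.mk _) (funext fun i => Category.id_comp (a i))
  comp_id := by
    intro X Y f
    induction f using Quotient.inductionOn with
    | _ a => exact congrArg (Quotient.mk _) (funext fun i => Category.comp_id (a i))
  assoc := by
    intro W X Y Z f g h
    induction f using Quotient.inductionOn with
    | _ a =>
      induction g using Quotient.inductionOn with
      | _ b =>
        induction h using Quotient.inductionOn with
        | _ c => exact congrArg (Quotient.mk _) (funext fun i => Category.assoc (a i) (b i) (c i))

/-- The morphism of the ultraproduct category determined by a family of morphisms. -/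
def UltraCat.mkHom {ι : Type u} (U : Ultrafilter ι) {C : ι → Type v}
    [∀ i, Category.{w} (C i)] {X Y : UltraCat U C} (f : ∀ i, X i ⟶ Y i) : X ⟶ Y :=
  Ultraproduct.mk U f

/-- The restricted ultraproduct of a family of simplicial sets: its `n`-simplices form
the ultraproduct of the sets of `n`-simplices, with germwise structure maps. -/
def ultraSSet {ι : Type u} (U : Ultrafilter ι) (X : ι → SSet.{v}) : SSet.{max u v} where
  obj m := Ultraproduct U (fun i => (X i).obj m)
  map {m m'} φ :=
    ↾(Quotient.map (fun s i => (X i).map φ (s i))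
      (by
        intro s t h
        exact Filter.mem_of_superset h (fun i hi => by
          show (X i).map φ (s i) = (X i).map φ (t i)
          rw [show s i = t i from hi])))
  map_id := by
    intro m
    refine ConcreteCategory.hom_ext _ _ fun a => ?_
    induction a using Quotient.inductionOn with
    | _ s =>
      exact congrArg (Quotient.mk _) (funext fun i => ConcreteCategory.congr_hom ((X i).map_id m) (s i))
  map_comp := by
    intro m m' m'' φ ψ
    refine ConcreteCategory.hom_ext _ _ fun a => ?_
    induction a using Quotient.inductionOn with
    | _ s =>
      exact congrArg (Quotient.mk _) (funext fun i => ConcreteCategory.congr_hom ((X i).map_comp φ ψ) (s i))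

/-- The germwise morphism between restricted ultraproducts induced by a family of
morphisms of simplicial sets. -/
def ultraSSetMap {ι : Type u} (U : Ultrafilter ι) {X Z : ι → SSet.{v}}
    (f : ∀ i, X i ⟶ Z i) : ultraSSet U X ⟶ ultraSSet U Z where
  app m :=
    ↾(Quotient.map (fun s i => (f i).app m (s i))
      (by
        intro s t h
        exact Filter.mem_of_superset h (fun i hi => by
          show (f i).app m (s i) = (f i).app m (t i)
          rw [show s i = t i from hi])))
  naturality := by
    intro m m' φ
    refine ConcreteCategory.hom_ext _ _ fun a => ?_
    induction a using Quotient.inductionOn with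
    | _ s =>
      exact congrArg (Quotient.mk _) (funext fun i => ConcreteCategory.congr_hom ((f i).naturality φ) (s i))

/-- A simplicial set `Y` is a Kan complex if for all `n ≥ 1` and `0 ≤ k ≤ n`, every map
from the horn `Λ[n, k]` to `Y` extends along `Λ[n, k] ↪ Δ[n]` to a map `Δ[n] ⟶ Y`. -/
def IsKan (Y : SSet.{v}) : Prop :=
  ∀ (n : ℕ), 1 ≤ n → ∀ (k : Fin (n + 1)) (σ : (Λ[n, k] : SSet.{v}) ⟶ Y),
    ∃ τ : Δ[n] ⟶ Y, Λ[n, k].ι ≫ τ = σ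

/-- A morphism of simplicial sets is a Kan fibration if it has the right lifting
property with respect to every horn inclusion `Λ[n, k] ↪ Δ[n]` (`n ≥ 1`, `0 ≤ k ≤ n`). -/
def IsKanFibration {X Z : SSet.{v}} (p : X ⟶ Z) : Prop :=
  ∀ (n : ℕ), 1 ≤ n → ∀ (k : Fin (n + 1)) (a : (Λ[n, k] : SSet.{v}) ⟶ X) (b : Δ[n] ⟶ Z),
    a ≫ p = Λ[n, k].ι ≫ b →
    ∃ c : Δ[n] ⟶ X, Λ[n, k].ι ≫ c = a ∧ c ≫ p = b

/-- Compatibility of a family of simplices, indexed by the faces of a horn. -/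
def HornCompat {X : SSet.{v}} {n : ℕ} {i : Fin (n + 2)}
    (x : ∀ (j : Fin (n + 2)) (_ : j ≠ i), X _⦋n⦌) : Prop :=
  match n with
  | 0 => True
  | n + 1 => ∀ (j k : Fin (n + 3)) (hj : j ≠ i) (hk : k ≠ i) (hjk : j < k),
      X.δ (k.pred (Fin.ne_zero_of_lt hjk)) (x j hj) =
      X.δ (j.castPred (Fin.ne_last_of_lt hjk)) (x k hk)

/-- Combinatorial form of the Kan condition. -/
def CombKan {X Z : SSet.{v}} (p : X ⟶ Z) : Prop :=
  ∀ (n : ℕ) (i : Fin (n + 2)) (x : ∀ (j : Fin (n + 2)) (_ : j ≠ i), X _⦋n⦌)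
    (b : Z _⦋n + 1⦌), HornCompat x → (∀ j hj, p.app _ (x j hj) = Z.δ j b) →
    ∃ c : X _⦋n + 1⦌, (∀ j, j ≠ i → ∀ hj, X.δ j c = x j hj) ∧ p.app _ c = b

theorem hornCompat_iff {X : SSet.{v}} {n : ℕ} {i : Fin (n + 2)}
    (f : ∀ (j : Fin (n + 2)) (_ : j ≠ i), (Δ[n] : SSet.{v}) ⟶ X) :
    SSet.horn.IsCompatible f ↔ HornCompat (fun j hj => SSet.yonedaEquiv (f j hj)) := by
  cases n with
  | zero => exact Iff.rfl
  | succ n =>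
    rw [SSet.horn.isCompatible_iff]
    simp only [HornCompat, ← SSet.stdSimplex.yonedaEquiv_δ_comp, EmbeddingLike.apply_eq_iff_eq]

theorem combKan_of {X Z : SSet.{v}} {p : X ⟶ Z} (h : IsKanFibration p) : CombKan p := by
  intro n i x b hx hb
  have hf : SSet.horn.IsCompatible
      (fun (j : Fin (n + 2)) (hj : j ≠ i) => SSet.yonedaEquiv.symm (x j hj)) := by
    rw [hornCompat_iff]; simpa using hx
  obtain ⟨c, h1, h2⟩ := h (n + 1) (by omega) i hf.desc (SSet.yonedaEquiv.symm b)
    (SSet.horn.hom_ext' (fun j hj => by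
      rw [SSet.horn.IsCompatible.ι_desc_assoc, SSet.horn.ι_ι_assoc,
        SSet.stdSimplex.δ_comp_yonedaEquiv_symm, SSet.yonedaEquiv_symm_comp, hb j hj]))
  refine ⟨SSet.yonedaEquiv c, fun j _ hj => ?_, ?_⟩
  · rw [← SSet.stdSimplex.yonedaEquiv_δ_comp, ← SSet.horn.ι_ι_assoc i j hj, h1,
      SSet.horn.IsCompatible.ι_desc, Equiv.apply_symm_apply]
  · rw [← SSet.yonedaEquiv_comp, h2, Equiv.apply_symm_apply]

theorem of_combKan {X Z : SSet.{v}} {p : X ⟶ Z} (h : CombKan p) : IsKanFibration p := by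
  intro n hn i a b hab
  obtain ⟨n, rfl⟩ : ∃ m, n = m + 1 := ⟨n - 1, by omega⟩
  obtain ⟨c, h1, h2⟩ := h n i (fun j hj => SSet.yonedaEquiv (SSet.horn.ι i j hj ≫ a))
    (SSet.yonedaEquiv b) ((hornCompat_iff _).1 (SSet.horn.IsCompatible.of_hom a))
    (fun j hj => by
      rw [← SSet.yonedaEquiv_comp, Category.assoc, hab, SSet.horn.ι_ι_assoc,
        SSet.stdSimplex.yonedaEquiv_δ_comp])
  refine ⟨SSet.yonedaEquiv.symm c, SSet.horn.hom_ext' fun j hj => ?_, ?_⟩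
  · rw [SSet.horn.ι_ι_assoc, SSet.stdSimplex.δ_comp_yonedaEquiv_symm, h1 j hj hj,
      Equiv.symm_apply_apply]
  · rw [SSet.yonedaEquiv_symm_comp, h2, Equiv.symm_apply_apply]

theorem mk_eq_iff {ι : Type u} (U : Ultrafilter ι) {S : ι → Type v} (s t : ∀ i, S i) :
    Ultraproduct.mk U s = Ultraproduct.mk U t ↔ ∀ᶠ i in (U : Filter ι), s i = t i :=
  Quotient.eq (r := germSetoid U S)

theorem combKan_ultra {ι : Type u} (U : Ultrafilter ι)
    {X Z : ι → SSet.{v}} (f : ∀ i, X i ⟶ Z i)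
    (h : ∀ᶠ i in (U : Filter ι), CombKan (f i)) : CombKan (ultraSSetMap U f) := by
  intro n k x b hx hb
  have hs : ∀ j hj, ∃ s : ∀ i, (X i) _⦋n⦌, Ultraproduct.mk U s = x j hj :=
    fun j hj => Quotient.exists_rep (x j hj)
  choose s hs using hs
  obtain rfl : (fun j hj => Ultraproduct.mk U (s j hj)) = x :=
    funext fun j => funext fun hj => hs j hj
  obtain ⟨t, rfl⟩ : ∃ t : ∀ i, (Z i) _⦋n + 1⦌, Ultraproduct.mk U t = b := Quotient.exists_rep b
  have e1 : ∀ᶠ i in (U : Filter ι), HornCompat (fun j hj => s j hj i) := by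
    cases n with
    | zero => exact Filter.Eventually.of_forall fun _ => trivial
    | succ n =>
      simp only [HornCompat, Filter.eventually_all]
      intro j l hj hl hjl
      exact (mk_eq_iff U _ _).1 (hx j l hj hl hjl)
  have e2 : ∀ᶠ i in (U : Filter ι), ∀ j hj, (f i).app _ (s j hj i) = (Z i).δ j (t i) := by
    simp only [Filter.eventually_all]
    intro j hj
    exact (mk_eq_iff U _ _).1 (hb j hj)
  have e3 : ∀ᶠ i in (U : Filter ι), ∃ c : (X i) _⦋n + 1⦌,
      (∀ j, j ≠ k → ∀ hj, (X i).δ j c = s j hj i) ∧ (f i).app _ c = t i := by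
    filter_upwards [h, e1, e2] with i h h1 h2
    exact h n k _ _ h1 h2
  classical
  let c : ∀ i, (X i) _⦋n + 1⦌ := fun i =>
    if hc : ∃ c : (X i) _⦋n + 1⦌,
      (∀ j, j ≠ k → ∀ hj, (X i).δ j c = s j hj i) ∧ (f i).app _ c = t i then hc.choose
    else (X i).σ 0 (s (k + 1) (by simp) i)
  have hc : ∀ᶠ i in (U : Filter ι),
      (∀ j, j ≠ k → ∀ hj, (X i).δ j (c i) = s j hj i) ∧ (f i).app _ (c i) = t i := by
    filter_upwards [e3] with i hi
    simp only [c, dif_pos hi]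
    exact hi.choose_spec
  refine ⟨Ultraproduct.mk U c, fun j _ hj => ?_, ?_⟩
  · exact (mk_eq_iff U _ _).2 (hc.mono fun i hi => hi.1 j hj hj)
  · exact (mk_eq_iff U _ _).2 (hc.mono fun i hi => hi.2)

/-- if `U`-almost every member of a family of morphisms of simplicial
sets is a Kan fibration, then the induced germwise morphism between the restricted
ultraproducts is a Kan fibration. -/
theorem ultraSSetMap_isKanFibration {ι : Type u} (U : Ultrafilter ι)
    {X Z : ι → SSet.{v}} (f : ∀ i, X i ⟶ Z i)
    (h : {i | IsKanFibration (f i)} ∈ U) : IsKanFibration (ultraSSetMap U f) := by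
  exact of_combKan (combKan_ultra U f (Filter.mem_of_superset h fun i hi => combKan_of hi))
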